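/- Let F_q be a finite field with q ≡ 1 (mod r) for every prime r dividing d, and if 4 divides d assume q ≡ 1 (mod 4), where d ≥ 2 is relatively prime to the characteristic of F_q. Let h(x) = a·x^d + c ∈ F_q[x] with a ≠ 0, and let g ∈ F_q[x] have degree k ≥ 1 and leading coefficient ℓ. Fix n ≥ 1 and suppose g ∘ h^{n−1} is irreducible over F_q. Set C = (−a)^k·ℓ if n = 1 and C = a^k·ℓ if n > 1; set D = (4a)^k·ℓ if n = 1 and D = a^k·ℓ if n > 1. Then g ∘ h^n is irreducible over F_q if and only if (g ∘ h^{n−1})(c)/C is not an r-th power in F_q for every prime r dividing d and, in case 4 divides d, (g ∘ h^{n−1})(c)/D is not a 4-th power in F_q. -/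

import Mathlib

open Polynomial

/-- The `n`-fold composition `f ∘ f ∘ ... ∘ f` (`n` times) of a polynomial,
with `f^0 = X` (the identity). -/
noncomputable def polyIter {K : Type*} [Field K] (f : K[X]) : ℕ → K[X]
  | 0 => X
  | n + 1 => f.comp (polyIter f n)

theorem X_pow_sub_C_irreducible_of_isSquare_neg_one {K : Type*} [Field K] {n : ℕ} (hn : n ≠ 0)
    (h4 : 4 ∣ n → IsSquare (-1 : K)) {a : K}
    (ha : ∀ p : ℕ, p.Prime → p ∣ n → ∀ b : K, b ^ p ≠ a) :
    Irreducible (X ^ n - C a) := by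
  induction n using induction_on_primes generalizing K a with
  | zero => exact absurd rfl hn
  | one => simpa using irreducible_X_sub_C a
  | prime_mul p n hp IH =>
    rw [mul_comm]
    apply X_pow_mul_sub_C_irreducible
      (X_pow_sub_C_irreducible_of_prime hp (ha p hp (dvd_mul_right _ _)))
    intro E _ _ x hx
    have hxi : IsIntegral K x := not_not.mp fun h ↦ by
      simpa only [degree_zero, degree_X_pow_sub_C hp.pos,
        WithBot.natCast_ne_bot] using congr_arg degree (hx.symm.trans (dif_neg h))
    have hnorm : Algebra.norm K (IntermediateField.AdjoinSimple.gen K x) = (-1) ^ p * -a := by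
      rw [← IntermediateField.adjoin.powerBasis_gen hxi,
        Algebra.PowerBasis.norm_gen_eq_coeff_zero_minpoly]
      simp [IntermediateField.minpoly_gen, hx, hp.ne_zero.symm]
    refine IH (right_ne_zero_of_mul hn) (fun h ↦ ?_) fun q hq hqn b hb ↦ ?_
    · simpa using (h4 (dvd_mul_of_dvd_right h p)).map (algebraMap K (IntermediateField.adjoin K {x}))
    · have key := congr_arg (Algebra.norm K) hb
      rw [map_pow, hnorm] at key
      have hqd : q ∣ p * n := dvd_mul_of_dvd_right hqn p
      rcases hp.eq_two_or_odd' with rfl | hodd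
      · rcases hq.eq_two_or_odd' with rfl | hqodd
        · obtain ⟨i, hi⟩ := h4 (mul_dvd_mul_left 2 hqn)
          refine ha 2 hq hqd (i * Algebra.norm K b) ?_
          rw [mul_pow, key, sq i, ← hi]
          ring
        · refine ha q hq hqd (-Algebra.norm K b) ?_
          rw [hqodd.neg_pow, key]
          ring
      · refine ha q hq hqd (Algebra.norm K b) ?_
        rw [key, hodd.neg_one_pow]
        ring

theorem FiniteField.exists_pow_eq_of_norm_eq_pow {K E : Type*} [Field K] [Field E] [Finite K]
    [Finite E] [Algebra K E] {r : ℕ} (hr : r ≠ 0) (hdvd : r ∣ Nat.card K - 1) {x : E} {u : K}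
    (hu : u ^ r = Algebra.norm K x) : ∃ y : E, y ^ r = x := by
  rcases eq_or_ne x 0 with rfl | hx
  · exact ⟨0, zero_pow hr⟩
  have hu0 : u ≠ 0 := by
    rintro rfl
    rw [zero_pow hr, eq_comm, Algebra.norm_eq_zero_iff] at hu
    exact hx hu
  obtain ⟨g, hg⟩ := IsCyclic.exists_generator (α := Eˣ)
  obtain ⟨j, hj⟩ := hg (Units.mk0 x hx)
  obtain ⟨w, hw⟩ := FiniteField.unitsMap_norm_surjective K E (Units.mk0 u hu0)
  obtain ⟨i, rfl⟩ := hg w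
  set N := Units.map (Algebra.norm K (S := E)) with hN
  have hgen : ∀ y : Kˣ, y ∈ Subgroup.zpowers (N g) := by
    intro y
    obtain ⟨z, rfl⟩ := FiniteField.unitsMap_norm_surjective K E y
    obtain ⟨l, rfl⟩ := hg z
    exact ⟨l, by simp [hN]⟩
  have hord : orderOf (N g) = Nat.card K - 1 := by
    rw [orderOf_eq_card_of_forall_mem_zpowers hgen, Nat.card_units]
  have hEq : N g ^ (i * r) = N g ^ j := by
    have h1 : Units.mk0 u hu0 ^ r = N (Units.mk0 x hx) := by
      ext
      simpa [hN] using hu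
    rw [← hj, ← hw] at h1
    simpa [zpow_mul] using h1
  have hdj : (r : ℤ) ∣ j := by
    have h2 : (r : ℤ) ∣ j - i * r :=
      (Int.natCast_dvd_natCast.mpr (hord ▸ hdvd)).trans
        (orderOf_dvd_sub_iff_zpow_eq_zpow.mpr hEq.symm)
    simpa using dvd_add h2 (dvd_mul_left (r : ℤ) i)
  obtain ⟨l, rfl⟩ := hdj
  refine ⟨((g ^ l : Eˣ) : E), ?_⟩
  have h3 := congr_arg Units.val hj
  simp only [Units.val_mk0] at h3
  rw [← h3, ← Units.val_pow_eq_pow_val, ← zpow_natCast, ← zpow_mul, mul_comm]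

theorem not_irreducible_comp_X_pow_of_pow_eq_root {K E : Type*} [Field K] [Field E] [Algebra K E]
    [FiniteDimensional K E] {f : K[X]} {d r : ℕ} (hd : d ≠ 0) (hr : r ≠ 1) (hrd : r ∣ d)
    (hfE : Module.finrank K E = f.natDegree) {y : E} (hy : aeval (y ^ r) f = 0) :
    ¬ Irreducible (f.comp (X ^ d)) := by
  intro hirr
  obtain ⟨s, rfl⟩ := hrd
  have hs : s ≠ 0 := right_ne_zero_of_mul hd
  obtain ⟨p, hp, hpd⟩ := WfDvdMonoid.exists_irreducible_factor
    (a := (X ^ s - C y : E[X]))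
    (by rw [isUnit_iff_degree_eq_zero, degree_X_pow_sub_C (Nat.pos_of_ne_zero hs)]
        exact_mod_cast hs) (X_pow_sub_C_ne_zero (Nat.pos_of_ne_zero hs) y)
  have : Fact (Irreducible p) := ⟨hp⟩
  have : FiniteDimensional E (AdjoinRoot p) := (AdjoinRoot.powerBasis hp.ne_zero).finite
  have : FiniteDimensional K (AdjoinRoot p) := FiniteDimensional.trans K E (AdjoinRoot p)
  have hz : AdjoinRoot.root p ^ s = algebraMap E (AdjoinRoot p) y := by
    have := eval₂_eq_zero_of_dvd_of_eval₂_eq_zero _ _ hpd (AdjoinRoot.eval₂_root p)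
    rwa [eval₂_sub, eval₂_pow, eval₂_C, eval₂_X, sub_eq_zero] at this
  have hroot : aeval (AdjoinRoot.root p) (f.comp (X ^ (r * s))) = 0 := by
    rw [aeval_comp, map_pow, aeval_X, mul_comm, pow_mul, hz, ← map_pow, aeval_algebraMap_apply,
      hy, map_zero]
  have hdeg := congr_arg natDegree (minpoly.eq_of_irreducible hirr hroot)
  rw [natDegree_mul_C (inv_ne_zero (leadingCoeff_ne_zero.mpr hirr.ne_zero)), natDegree_comp,
    natDegree_X_pow] at hdeg
  have hle := minpoly.natDegree_le (A := K) (AdjoinRoot.root p)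
  rw [← Module.finrank_mul_finrank K E (AdjoinRoot p), ← hdeg, hfE,
    (AdjoinRoot.powerBasis hp.ne_zero).finrank, AdjoinRoot.powerBasis_dim hp.ne_zero] at hle
  have hps : p.natDegree ≤ s :=
    (natDegree_le_of_dvd hpd (X_pow_sub_C_ne_zero (Nat.pos_of_ne_zero hs) y)).trans_eq
      natDegree_X_pow_sub_C
  have hf : 0 < f.natDegree := hfE ▸ Module.finrank_pos
  have h1 : r * s ≤ s := (Nat.le_of_mul_le_mul_left hle hf).trans hps
  have h2 : r ≤ 1 := Nat.le_of_mul_le_mul_right (by simpa using h1) (Nat.pos_of_ne_zero hs)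
  have h3 : r ≠ 0 := left_ne_zero_of_mul hd
  omega

theorem Polynomial.Monic.irreducible_comp_X_pow_iff {K : Type*} [Field K] [Finite K] {f : K[X]}
    (hm : f.Monic) (hf : Irreducible f) {d : ℕ} (hd : d ≠ 0)
    (hdvd : ∀ r : ℕ, r.Prime → r ∣ d → r ∣ Nat.card K - 1) (h4 : 4 ∣ d → IsSquare (-1 : K)) :
    Irreducible (f.comp (X ^ d)) ↔
      ∀ r : ℕ, r.Prime → r ∣ d → ¬ ∃ v : K, v ^ r = (-1) ^ f.natDegree * f.coeff 0 := by
  constructor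
  · rintro hirr r hr hrd ⟨v, hv⟩
    have : Fact (Irreducible f) := ⟨hf⟩
    have hfd : FiniteDimensional K (AdjoinRoot f) := (AdjoinRoot.powerBasis hf.ne_zero).finite
    have : Finite (AdjoinRoot f) := Module.finite_of_finite K
    have hnorm : Algebra.norm K (AdjoinRoot.root f) = (-1) ^ f.natDegree * f.coeff 0 := by
      rw [← AdjoinRoot.powerBasis_gen hf.ne_zero,
        Algebra.PowerBasis.norm_gen_eq_coeff_zero_minpoly, AdjoinRoot.powerBasis_dim,
        AdjoinRoot.minpoly_powerBasis_gen_of_monic hm]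
    obtain ⟨y, hy⟩ := FiniteField.exists_pow_eq_of_norm_eq_pow hr.ne_zero (hdvd r hr hrd)
      (hv.trans hnorm.symm)
    refine not_irreducible_comp_X_pow_of_pow_eq_root hd hr.ne_one hrd
      (E := AdjoinRoot f) (y := y) ?_ ?_ hirr
    · rw [(AdjoinRoot.powerBasis hf.ne_zero).finrank, AdjoinRoot.powerBasis_dim hf.ne_zero]
    · rw [hy, AdjoinRoot.aeval_eq, AdjoinRoot.mk_self]
  · intro H
    refine irreducible_comp hm (monic_X_pow d) hf fun E _ _ x hx ↦ ?_
    have hxi : IsIntegral K x := not_not.mp fun h ↦ hf.ne_zero (hx ▸ minpoly.eq_zero h)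
    rw [Polynomial.map_pow, map_X]
    refine X_pow_sub_C_irreducible_of_isSquare_neg_one hd (fun h ↦ ?_) fun r hr hrd b hb ↦ ?_
    · simpa using (h4 h).map (algebraMap K (IntermediateField.adjoin K {x}))
    · refine H r hr hrd ⟨Algebra.norm K b, ?_⟩
      rw [← map_pow, hb, ← IntermediateField.adjoin.powerBasis_gen hxi,
        Algebra.PowerBasis.norm_gen_eq_coeff_zero_minpoly, IntermediateField.adjoin.powerBasis_gen,
        IntermediateField.minpoly_gen, hx, IntermediateField.adjoin.powerBasis_dim, hx]

theorem irreducible_comp_C_mul_X_pow_add_C_iff {K : Type*} [Field K] [Finite K] {P : K[X]}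
    (hP : Irreducible P) {a c : K} (ha : a ≠ 0) {d : ℕ} (hd : d ≠ 0)
    (hdvd : ∀ r : ℕ, r.Prime → r ∣ d → r ∣ Nat.card K - 1) (h4 : 4 ∣ d → IsSquare (-1 : K)) :
    Irreducible (P.comp (C a * X ^ d + C c)) ↔
      ∀ r : ℕ, r.Prime → r ∣ d →
        ¬ ∃ v : K, v ^ r = P.eval c / ((-a) ^ P.natDegree * P.leadingCoeff) := by
  have hl := leadingCoeff_ne_zero.mpr hP.ne_zero
  have hdeg1 : (C a * X + C c).natDegree = 1 := natDegree_linear ha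
  set Q := P.comp (C a * X + C c) with hQ
  have hQdeg : Q.natDegree = P.natDegree := by rw [hQ, natDegree_comp, hdeg1, mul_one]
  have hQlead : Q.leadingCoeff = P.leadingCoeff * a ^ P.natDegree := by
    rw [hQ, leadingCoeff_comp (by rw [hdeg1]; exact one_ne_zero), leadingCoeff_linear ha]
  have hQirr : Irreducible Q := by
    let := invertibleOfNonzero ha
    have := (MulEquiv.irreducible_iff (algEquivCMulXAddC a c)).mpr hP
    simpa [algEquivCMulXAddC_apply, ← comp_eq_aeval] using this
  have hQl : Q.leadingCoeff ≠ 0 := leadingCoeff_ne_zero.mpr hQirr.ne_zero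
  have hu : IsUnit (C Q.leadingCoeff⁻¹) := isUnit_C.mpr (inv_ne_zero hQl).isUnit
  have hcomp : (Q * C Q.leadingCoeff⁻¹).comp (X ^ d) =
      P.comp (C a * X ^ d + C c) * C Q.leadingCoeff⁻¹ := by
    rw [mul_comp, C_comp, hQ, comp_assoc]
    simp
  rw [← irreducible_mul_isUnit hu, ← hcomp,
    (monic_mul_leadingCoeff_inv hQirr.ne_zero).irreducible_comp_X_pow_iff
      ((irreducible_mul_isUnit hu).mpr hQirr) hd hdvd h4,
    natDegree_mul_C (inv_ne_zero hQl), hQdeg, coeff_mul_C, hQlead, hQ, coeff_zero_eq_eval_zero]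
  have : (-1) ^ P.natDegree * (eval 0 (P.comp (C a * X + C c)) *
      (P.leadingCoeff * a ^ P.natDegree)⁻¹) =
      P.eval c / ((-a) ^ P.natDegree * P.leadingCoeff) := by
    have h1 : ((-1 : K) ^ P.natDegree) * (-1) ^ P.natDegree = 1 := by
      rw [← mul_pow]; simp
    rw [neg_pow a, eval_comp, div_eq_mul_inv]
    simp only [eval_add, eval_mul, eval_C, eval_X, mul_zero, zero_add, mul_inv]
    rw [inv_eq_of_mul_eq_one_right h1]
    ring
  rw [this]

theorem polyIter_succ_comp {K : Type*} [Field K] (f : K[X]) (n : ℕ) :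
    polyIter f (n + 1) = (polyIter f n).comp f := by
  induction n with
  | zero => simp [polyIter]
  | succ n ih =>
    rw [polyIter, ih, ← comp_assoc]
    exact congr_arg (·.comp f) ih

theorem natDegree_polyIter {K : Type*} [Field K] (f : K[X]) (n : ℕ) :
    (polyIter f n).natDegree = f.natDegree ^ n := by
  induction n with
  | zero => simp [polyIter]
  | succ n ih => rw [polyIter, natDegree_comp, ih, pow_succ']

theorem leadingCoeff_polyIter_succ {K : Type*} [Field K] {f : K[X]} (hf : f.natDegree ≠ 0)
    (n : ℕ) :
    (polyIter f (n + 1)).leadingCoeff =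
      f.leadingCoeff * (polyIter f n).leadingCoeff ^ f.natDegree := by
  rw [polyIter, leadingCoeff_comp (by rw [natDegree_polyIter]; exact pow_ne_zero n hf)]

theorem exists_pow_eq_div_mul_pow_iff {K : Type*} [Field K] {r : ℕ} {x y w : K} (hw : w ≠ 0) :
    (∃ v : K, v ^ r = x / (y * w ^ r)) ↔ ∃ v : K, v ^ r = x / y := by
  constructor
  · rintro ⟨v, hv⟩
    refine ⟨v * w, ?_⟩
    rw [mul_pow, hv]
    field_simp
  · rintro ⟨v, hv⟩
    refine ⟨v / w, ?_⟩
    rw [div_pow, hv, div_div]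

theorem stmt3 {K : Type*} [Field K] [Fintype K] {q d k n : ℕ}
    (hq : Fintype.card K = q) (hd : 2 ≤ d)
    (hchar : Nat.Coprime (ringChar K) d)
    (hcong : ∀ r : ℕ, r.Prime → r ∣ d → q % r = 1)
    (hcong4 : 4 ∣ d → q % 4 = 1)
    (a c : K) (ha : a ≠ 0) (h : K[X]) (hh : h = C a * X ^ d + C c)
    (g : K[X]) (hgk : g.natDegree = k) (hk : 1 ≤ k)
    (hn : 1 ≤ n)
    (hprev : Irreducible (g.comp (polyIter h (n - 1)))) :
    Irreducible (g.comp (polyIter h n)) ↔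
      ((∀ r : ℕ, r.Prime → r ∣ d →
          ¬ ∃ v : K, v ^ r = (g.comp (polyIter h (n - 1))).eval c /
            (if n = 1 then (-a) ^ k * g.leadingCoeff else a ^ k * g.leadingCoeff)) ∧
       (4 ∣ d →
          ¬ ∃ v : K, v ^ 4 = (g.comp (polyIter h (n - 1))).eval c /
            (if n = 1 then (4 * a) ^ k * g.leadingCoeff else a ^ k * g.leadingCoeff))) := by
  have hd0 : d ≠ 0 := by omega
  have hdvd : ∀ r : ℕ, r.Prime → r ∣ d → r ∣ Nat.card K - 1 := fun r hr hrd ↦ by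
    rw [Nat.card_eq_fintype_card, hq, ← hcong r hr hrd]
    exact Nat.dvd_sub_mod q
  have hsq : 4 ∣ d → IsSquare (-1 : K) := fun h4 ↦ by
    rw [FiniteField.isSquare_neg_one_iff, hq, hcong4 h4]
    decide
  have hdeg : h.natDegree = d := by
    rw [hh, natDegree_add_C, natDegree_C_mul_X_pow d a ha]
  have hlead : h.leadingCoeff = a := by
    rw [leadingCoeff, hdeg, hh, coeff_add, coeff_C_mul_X_pow, coeff_C_of_ne_zero hd0, add_zero,
      if_pos rfl]
  obtain ⟨m, rfl⟩ : ∃ m, n = m + 1 := ⟨n - 1, by omega⟩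
  rw [Nat.add_sub_cancel] at hprev ⊢
  rw [polyIter_succ_comp, ← comp_assoc]
  nth_rewrite 2 [hh]
  rw [irreducible_comp_C_mul_X_pow_add_C_iff hprev ha hd0 hdvd hsq]
  cases m with
  | zero =>
    simp only [polyIter, comp_X, zero_add, if_true, hgk]
    refine ⟨fun H ↦ ⟨H, fun h4 ↦ ?_⟩, And.left⟩
    rintro ⟨v, hv⟩
    obtain ⟨i, hi⟩ := hsq h4
    have h2 : (4 : K) ≠ 0 := by
      have hodd : Fintype.card K % 2 = 1 := by have := hcong4 h4; omega
      have h20 := Ring.two_ne_zero (R := K) fun h2 ↦ by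
        have := FiniteField.even_card_of_char_two h2; omega
      rw [show (4 : K) = 2 * 2 by norm_num]
      exact mul_ne_zero h20 h20
    refine H 2 Nat.prime_two (dvd_trans (by norm_num) h4) ⟨v ^ 2 * (2 * i) ^ k, ?_⟩
    have hi4 : ((2 * i) ^ k) ^ 2 = (-4 : K) ^ k := by
      rw [← pow_mul, mul_comm k, pow_mul, mul_pow, sq i, ← hi]
      norm_num
    have hgl : g.leadingCoeff ≠ 0 := by
      rw [leadingCoeff_ne_zero]; rintro rfl; simp at hgk; omega
    rw [mul_pow, ← pow_mul, hv, hi4, mul_pow, neg_pow a, neg_pow 4]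
    have h1 : ((-1 : K) ^ k) * (-1) ^ k = 1 := by rw [← mul_pow]; simp
    field_simp
    linear_combination (eval c g) * h1
  | succ m =>
    have hne : ¬ (m + 1 + 1 = 1) := by omega
    simp only [if_neg hne]
    have hpd : (polyIter h (m + 1)).natDegree = d ^ (m + 1) := by rw [natDegree_polyIter, hdeg]
    have hpdeg : (polyIter h (m + 1)).natDegree ≠ 0 := by rw [hpd]; exact pow_ne_zero _ hd0
    have hpl : (polyIter h m).leadingCoeff ≠ 0 := by
      intro h0
      have h1 := natDegree_polyIter h m
      rw [leadingCoeff_eq_zero.mp h0, natDegree_zero, hdeg] at h1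
      exact pow_ne_zero m hd0 h1.symm
    have key : ∀ r : ℕ, r ∣ d → ((∃ v : K, v ^ r = eval c (g.comp (polyIter h (m + 1))) /
        ((-a) ^ (g.comp (polyIter h (m + 1))).natDegree *
          (g.comp (polyIter h (m + 1))).leadingCoeff)) ↔
        ∃ v : K, v ^ r = eval c (g.comp (polyIter h (m + 1))) / (a ^ k * g.leadingCoeff)) := by
      rintro r ⟨s, hs⟩
      rw [← exists_pow_eq_div_mul_pow_iff (y := a ^ k * g.leadingCoeff)
        (w := (-a) ^ (k * d ^ m * s) * (polyIter h m).leadingCoeff ^ (s * k))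
        (mul_ne_zero (pow_ne_zero _ (neg_ne_zero.mpr ha)) (pow_ne_zero _ hpl)),
        leadingCoeff_comp hpdeg, natDegree_comp, hpd, hgk,
        leadingCoeff_polyIter_succ (hdeg ▸ hd0), hlead, hdeg]
      have : (-a) ^ (k * d ^ (m + 1)) *
          (g.leadingCoeff * (a * (polyIter h m).leadingCoeff ^ d) ^ k) =
          a ^ k * g.leadingCoeff *
          ((-a) ^ (k * d ^ m * s) * (polyIter h m).leadingCoeff ^ (s * k)) ^ r := by
        rw [mul_pow _ _ r, ← pow_mul, ← pow_mul, mul_pow a, ← pow_mul,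
          show k * d ^ m * s * r = k * d ^ (m + 1) by rw [pow_succ, hs]; ring,
          show s * k * r = d * k by rw [hs]; ring]
        ring
      rw [this]
    refine ⟨fun H ↦ ⟨fun r hr hrd ↦ (key r hrd).not.mp (H r hr hrd), ?_⟩,
      fun H r hr hrd ↦ (key r hrd).not.mpr (H.1 r hr hrd)⟩
    rintro h4 ⟨v, hv⟩
    have h2d : 2 ∣ d := dvd_trans (by norm_num) h4
    exact (key 2 h2d).not.mp (H 2 Nat.prime_two h2d) ⟨v ^ 2, by rw [← pow_mul, hv]⟩
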